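/- Let D be poised Birkhoff interpolation data with (y^0, 0) ∈ D, every |α^i| ≤ 2, and Δ(Y) ≤ Δ. Let f : R^n → R be twice continuously differentiable with ∇²f Lipschitz continuous with constant L on an open set containing B̄(y^0, 2Δ), and let m(y^0 + s) = c + g^T s + (1/2) s^T H s be the quadratic Birkhoff interpolant of f, i.e., (∂^{α^i} m)(y^i) = (∂^{α^i} f)(y^i) for all i = 0, …, q. Let n_ℓ = #{i : |α^i| = ℓ} for ℓ = 0, 1, 2. Then for all y in the closed ball B̄(y^0, Δ), the function-value error satisfies |m(y) − f(y)| ≤ (4/3 + 2(1 + 2√2) · ((9/4)n_0 + 4 n_1 + 4 n_2)^{1/2} · ‖M̂^{-1}‖₂) · L · Δ³. -/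

import Mathlib

noncomputable section

open Metric

/-- `ℝ^n` with the Euclidean norm. -/
abbrev E (n : ℕ) := EuclideanSpace ℝ (Fin n)

/-- Partial derivative in coordinate `i`. -/
def pd {n : ℕ} (i : Fin n) (f : E n → ℝ) : E n → ℝ :=
  fun x => fderiv ℝ f x (EuclideanSpace.single i 1)

/-- Mixed partial derivative `∂^α` associated with the multi-index `α`. -/
def mpd {n : ℕ} (α : Fin n → ℕ) (f : E n → ℝ) : E n → ℝ :=
  (List.finRange n).foldr (fun i g => (pd i)^[α i] g) f

/-- The order `|α|` of a multi-index. -/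
def mdeg {n : ℕ} (α : Fin n → ℕ) : ℕ := ∑ j, α j

/-- Index type for the natural basis of quadratic polynomials in `n` variables:
`1`, the `n` linear monomials, and the quadratic monomials indexed by unordered pairs.
Its cardinality is `q + 1 = (n+1)(n+2)/2`. -/
abbrev BIdx (n : ℕ) := Unit ⊕ Fin n ⊕ Sym2 (Fin n)

/-- The natural basis `1, x_1, …, x_n, (1/2)x_1², x_1x_2, …, (1/2)x_n²` of `P_n^2`. -/
def natBasis {n : ℕ} : BIdx n → E n → ℝ
  | Sum.inl _ => fun _ => 1
  | Sum.inr (Sum.inl i) => fun x => x i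
  | Sum.inr (Sum.inr s) => fun x =>
      Sym2.lift ⟨fun i j => (if i = j then (1:ℝ)/2 else 1) * (x i * x j), by
        intro a b
        by_cases h : a = b
        · subst h; ring
        · simp only [if_neg h, if_neg (Ne.symm h)]; ring⟩ s

/-- The base point `y^0` of interpolation data. -/
def center {n : ℕ} (y : BIdx n → E n) : E n := y (Sum.inl ())

/-- `Δ(Y) = max_i ‖y^i − y^0‖`. -/
def rad {n : ℕ} (y : BIdx n → E n) : ℝ :=
  Finset.univ.sup' Finset.univ_nonempty fun i => ‖y i - center y‖

/-- The normalized points `ŷ^i = (y^i − y^0)/Δ(Y)`. -/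
def yhat {n : ℕ} (y : BIdx n → E n) (i : BIdx n) : E n := (rad y)⁻¹ • (y i - center y)

/-- The normalized interpolation matrix `M̂_{ij} = (∂^{α^i} φ_j)(ŷ^i)`. -/
def Mhat {n : ℕ} (y : BIdx n → E n) (α : BIdx n → Fin n → ℕ) : Matrix (BIdx n) (BIdx n) ℝ :=
  Matrix.of fun i j => mpd (α i) (natBasis j) (yhat y i)

/-- The quadratic polynomial with coefficient vector `v` in the natural basis. -/
def evalP {n : ℕ} (v : BIdx n → ℝ) : E n → ℝ := fun x => ∑ j, v j * natBasis j x

/-- `v` lists the coefficient vectors of the Birkhoff interpolation polynomials: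
`∂^{α^{i'}} λ_i (ŷ^{i'}) = δ_{i i'}`. -/
def BirkhoffLam {n : ℕ} (y : BIdx n → E n) (α : BIdx n → Fin n → ℕ)
    (v : BIdx n → BIdx n → ℝ) : Prop :=
  ∀ i i', mpd (α i') (evalP (v i)) (yhat y i') = if i = i' then 1 else 0

/-- The spectral (ℓ²-operator) norm of a real matrix. -/
def specNorm {ι : Type*} [Fintype ι] [DecidableEq ι] (M : Matrix ι ι ℝ) : ℝ :=
  ‖Matrix.toEuclideanCLM (𝕜 := ℝ) M‖

/-- `q + 1 = (n+1)(n+2)/2`. -/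
def Q1 (n : ℕ) : ℕ := (n + 1) * (n + 2) / 2

/-- The quadratic model `m(y^0 + s) = c + gᵀs + (1/2)sᵀHs`, as a function of `x = y^0 + s`. -/
def quadModel {n : ℕ} (c : ℝ) (g : Fin n → ℝ) (H : Matrix (Fin n) (Fin n) ℝ)
    (y0 : E n) : E n → ℝ :=
  fun x => c + (∑ i, g i * (x i - y0 i)) +
    (1 / 2) * ∑ i, ∑ j, (x i - y0 i) * H i j * (x j - y0 j)

/-- The Hessian matrix of `f` at `x`. -/
def hessMat {n : ℕ} (f : E n → ℝ) (x : E n) : Matrix (Fin n) (Fin n) ℝ :=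
  Matrix.of fun i j =>
    fderiv ℝ (fderiv ℝ f) x (EuclideanSpace.single i 1) (EuclideanSpace.single j 1)

/-- The gradient of `f` at `x` as a vector. -/
def gradVec {n : ℕ} (f : E n → ℝ) (x : E n) : Fin n → ℝ :=
  fun i => fderiv ℝ f x (EuclideanSpace.single i 1)

/-- `n_ℓ`, the number of interpolation conditions of derivative order `ℓ`. -/
def ncount {n : ℕ} (α : BIdx n → Fin n → ℕ) (ℓ : ℕ) : ℕ :=
  (Finset.univ.filter fun i => mdeg (α i) = ℓ).card

/-- `((9/4)n_0 + 4n_1 + 4n_2)^{1/2}`. -/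
def kfac {n : ℕ} (α : BIdx n → Fin n → ℕ) : ℝ :=
  Real.sqrt ((9 / 4) * ncount α 0 + 4 * ncount α 1 + 4 * ncount α 2)


/-- iterated partial derivatives along a list of directions -/
def lpd {n : ℕ} (w : List (Fin n)) (f : E n → ℝ) : E n → ℝ := w.foldr (fun i g => pd i g) f

lemma iter_lpd {n : ℕ} (i : Fin n) (k : ℕ) (f : E n → ℝ) :
    (pd i)^[k] f = lpd (List.replicate k i) f := by
  induction k with
  | zero => rfl
  | succ k ih => rw [Function.iterate_succ_apply', ih]; rfl

lemma lpd_append {n : ℕ} (w w' : List (Fin n)) (f : E n → ℝ) :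
    lpd (w ++ w') f = lpd w (lpd w' f) := by
  simp [lpd, List.foldr_append]

lemma mpd_eq {n : ℕ} (α : Fin n → ℕ) :
    ∃ w : List (Fin n), w.length = mdeg α ∧ ∀ f, mpd α f = lpd w f := by
  have key : ∀ l : List (Fin n), ∃ w : List (Fin n), w.length = (l.map α).sum ∧
      ∀ f, l.foldr (fun i g => (pd i)^[α i] g) f = lpd w f := by
    intro l
    induction l with
    | nil => exact ⟨[], rfl, fun f => rfl⟩
    | cons a l ih =>
      obtain ⟨w, hw, h⟩ := ih
      refine ⟨List.replicate (α a) a ++ w, by simp [hw], fun f => ?_⟩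
      rw [List.foldr_cons, h, iter_lpd, lpd_append]
  obtain ⟨w, hw, h⟩ := key (List.finRange n)
  refine ⟨w, ?_, h⟩
  rw [hw, mdeg]
  simp [List.sum_ofFn, ← List.ofFn_eq_map]

open scoped ContDiff

lemma contDiff_pd {n : ℕ} (i : Fin n) {f : E n → ℝ} (hf : ContDiff ℝ ∞ f) :
    ContDiff ℝ ∞ (pd i f) := by
  have h : ContDiff ℝ ∞ (fderiv ℝ f) := hf.fderiv_right (by simp)
  exact h.clm_apply contDiff_const

lemma contDiff_lpd {n : ℕ} (w : List (Fin n)) {f : E n → ℝ} (hf : ContDiff ℝ ∞ f) :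
    ContDiff ℝ ∞ (lpd w f) := by
  induction w with
  | nil => exact hf
  | cons a w ih => exact contDiff_pd a ih

lemma lpd_sum {n : ℕ} (w : List (Fin n)) {ι : Type*} [Fintype ι] (v : ι → ℝ)
    (F : ι → E n → ℝ) (hF : ∀ j, ContDiff ℝ ∞ (F j)) :
    lpd w (fun x => ∑ j, v j * F j x) = fun x => ∑ j, v j * lpd w (F j) x := by
  induction w with
  | nil => rfl
  | cons a w ih =>
    show pd a (lpd w _) = _
    rw [ih]
    funext x
    have hd : ∀ j, DifferentiableAt ℝ (lpd w (F j)) x := fun j =>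
      ((contDiff_lpd w (hF j)).differentiable (by simp)).differentiableAt
    have : HasFDerivAt (fun x => ∑ j, v j * lpd w (F j) x)
        (∑ j, v j • fderiv ℝ (lpd w (F j)) x) x :=
      HasFDerivAt.fun_sum fun j _ => (hd j).hasFDerivAt.const_mul (v j)
    simp only [pd]
    rw [this.fderiv]
    simp [lpd, pd]

lemma lpd_sub {n : ℕ} (w : List (Fin n)) (F G : E n → ℝ) (hF : ContDiff ℝ ∞ F)
    (hG : ContDiff ℝ ∞ G) :
    lpd w (fun x => F x - G x) = fun x => lpd w F x - lpd w G x := by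
  have := lpd_sum w (ι := Bool) (fun b => if b then 1 else -1) (fun b => if b then F else G)
    (by intro b; cases b <;> simp [hF, hG])
  simpa [sub_eq_add_neg] using this

lemma lpd_scale {n : ℕ} (w : List (Fin n)) (a : ℝ) (y0 : E n) (F : E n → ℝ)
    (hF : ContDiff ℝ ∞ F) :
    lpd w (fun x => F (a • (x - y0))) = fun x => a ^ w.length * lpd w F (a • (x - y0)) := by
  induction w with
  | nil => simp [lpd]
  | cons b w ih =>
    show pd b (lpd w _) = _
    rw [ih]
    funext x
    have hd : DifferentiableAt ℝ (lpd w F) (a • (x - y0)) :=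
      ((contDiff_lpd w hF).differentiable (by simp)).differentiableAt
    have h1 : HasFDerivAt (fun x : E n => a • (x - y0)) (a • ContinuousLinearMap.id ℝ (E n)) x :=
      ((hasFDerivAt_id x).sub_const y0).const_smul a
    have h2 := (hd.hasFDerivAt.comp x h1).const_mul (a ^ w.length)
    simp only [Function.comp_def] at h2
    simp only [pd]
    rw [h2.fderiv]
    simp [lpd, pd, pow_succ, mul_assoc]

lemma contDiff_natBasis {n : ℕ} (j : BIdx n) : ContDiff ℝ ∞ (natBasis (n := n) j) := by
  rcases j with _ | i | s
  · exact contDiff_const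
  · show ContDiff ℝ ∞ (fun x : E n => x i)
    fun_prop
  · induction s using Sym2.ind with
    | _ i j =>
      show ContDiff ℝ ∞ (fun x : E n => (if i = j then (1:ℝ)/2 else 1) * (x i * x j))
      fun_prop

lemma sum_sym2 {n : ℕ} (G : Fin n → Fin n → ℝ) (F : Sym2 (Fin n) → ℝ)
    (h : ∀ i j, F s(i, j) = if i = j then G i i else G i j + G j i) :
    ∑ i, ∑ j, G i j = ∑ s, F s := by
  rw [← Finset.sum_product', Finset.univ_product_univ,
    ← Finset.sum_fiberwise (s := Finset.univ) (g := fun p : Fin n × Fin n => s(p.1, p.2))]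
  refine Finset.sum_congr rfl fun s _ => ?_
  induction s using Sym2.ind with
  | _ a b =>
    rw [h]
    by_cases hab : a = b
    · subst hab
      have : (Finset.univ.filter fun p : Fin n × Fin n => s(p.1, p.2) = s(a, a)) = {(a, a)} := by
        ext ⟨p, q⟩; simp
      rw [this]; simp
    · have : (Finset.univ.filter fun p : Fin n × Fin n => s(p.1, p.2) = s(a, b))
          = {(a, b), (b, a)} := by
        ext ⟨p, q⟩; simp
      rw [this, Finset.sum_pair (by simp [hab])]; simp [hab]

/-- coefficient vector of a scaled quadratic -/
def cvec {n : ℕ} (c : ℝ) (g : Fin n → ℝ) (H : Matrix (Fin n) (Fin n) ℝ) (hH : H.IsSymm) (d : ℝ) :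
    BIdx n → ℝ
  | Sum.inl _ => c
  | Sum.inr (Sum.inl i) => d * g i
  | Sum.inr (Sum.inr s) => Sym2.lift ⟨fun i j => d ^ 2 * H i j, fun a b => by
      show d ^ 2 * H a b = d ^ 2 * H b a
      rw [hH.apply a b]⟩ s

lemma evalP_cvec {n : ℕ} (c : ℝ) (g : Fin n → ℝ) (H : Matrix (Fin n) (Fin n) ℝ) (hH : H.IsSymm)
    (d : ℝ) (hd : d ≠ 0) (y0 x : E n) :
    quadModel c g H y0 x = evalP (cvec c g H hH d) (d⁻¹ • (x - y0)) := by
  simp only [quadModel, evalP, Fintype.sum_sum_type]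
  have h2 : (1 / 2 : ℝ) * ∑ i, ∑ j, (x i - y0 i) * H i j * (x j - y0 j)
      = ∑ s : Sym2 (Fin n), cvec c g H hH d (Sum.inr (Sum.inr s)) *
        natBasis (Sum.inr (Sum.inr s)) (d⁻¹ • (x - y0)) := by
    simp only [Finset.mul_sum]
    refine sum_sym2 _ _ fun i j => ?_
    simp only [cvec, natBasis, Sym2.lift_mk]
    by_cases hij : i = j
    · subst hij; simp; field_simp
    · simp [hij, hH.apply i j]; field_simp; ring
  rw [h2]
  have h1 : ∑ i, g i * (x i - y0 i) = ∑ i, cvec c g H hH d (Sum.inr (Sum.inl i)) *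
        natBasis (Sum.inr (Sum.inl i)) (d⁻¹ • (x - y0)) := by
    refine Finset.sum_congr rfl fun i _ => ?_
    simp [cvec, natBasis]; field_simp
  rw [h1]
  simp [cvec, natBasis]; ring

lemma natBasis_norm {n : ℕ} (x : E n) :
    ∑ j, (natBasis j x) ^ 2 ≤ 1 + ‖x‖ ^ 2 + ‖x‖ ^ 4 := by
  simp only [Fintype.sum_sum_type]
  have hx : ‖x‖ ^ 2 = ∑ i, x i ^ 2 := by
    rw [EuclideanSpace.norm_sq_eq]; simp
  have h4 : ‖x‖ ^ 4 = ∑ i, ∑ j, x i ^ 2 * x j ^ 2 := by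
    rw [← Finset.sum_mul_sum, ← hx]; ring
  have hs : ∑ s : Sym2 (Fin n), (natBasis (Sum.inr (Sum.inr s)) x) ^ 2 ≤ ‖x‖ ^ 4 := by
    rw [h4, sum_sym2 (fun i j => x i ^ 2 * x j ^ 2) (Sym2.lift ⟨fun i j => if i = j then
      x i ^ 2 * x i ^ 2 else x i ^ 2 * x j ^ 2 + x j ^ 2 * x i ^ 2, by
        intro a b
        by_cases h : a = b
        · subst h; rfl
        · simp only [if_neg h, if_neg (Ne.symm h)]; ring⟩) (fun i j => rfl)]
    refine Finset.sum_le_sum fun s _ => ?_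
    induction s using Sym2.ind with
    | _ a b =>
      simp only [natBasis, Sym2.lift_mk]
      by_cases h : a = b
      · subst h; simp only [if_true]; nlinarith [sq_nonneg (x a * x a)]
      · simp only [if_neg h]; nlinarith [sq_nonneg (x a * x b)]
  have hl : ∑ i : Fin n, (natBasis (Sum.inr (Sum.inl i)) x) ^ 2 = ‖x‖ ^ 2 := by
    rw [hx]; rfl
  rw [hl]
  simp [natBasis] at hs ⊢
  linarith

lemma contDiff_quad {n : ℕ} (c : ℝ) (g : Fin n → ℝ) (H : Matrix (Fin n) (Fin n) ℝ) (y0 : E n) :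
    ContDiff ℝ ∞ (quadModel c g H y0) := by
  unfold quadModel
  fun_prop

lemma quad_sub {n : ℕ} (c c' : ℝ) (g g' : Fin n → ℝ) (H H' : Matrix (Fin n) (Fin n) ℝ) (y0 : E n) :
    quadModel (c - c') (g - g') (H - H') y0 =
      fun x => quadModel c g H y0 x - quadModel c' g' H' y0 x := by
  funext x
  simp only [quadModel, Pi.sub_apply, Matrix.sub_apply, sub_mul, mul_sub, Finset.sum_sub_distrib]
  ring

lemma expand {n : ℕ} (x : E n) : x = ∑ i, x i • (EuclideanSpace.single i (1:ℝ) : E n) := by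
  ext k
  simp [Finset.sum_apply, Pi.single_apply]

lemma bil_expand {n : ℕ} (B : E n →L[ℝ] E n →L[ℝ] ℝ) (u v : E n) :
    B u v = ∑ i, ∑ j, u i * B (EuclideanSpace.single i 1) (EuclideanSpace.single j 1) * v j := by
  conv_lhs => rw [expand u, expand v]
  simp only [map_sum, map_smul, _root_.sum_apply, _root_.smul_apply,
    smul_eq_mul, Finset.mul_sum]
  rw [Finset.sum_comm]
  refine Finset.sum_congr rfl fun i _ => Finset.sum_congr rfl fun j _ => ?_
  ring

lemma bil_norm {n : ℕ} (B : E n →L[ℝ] E n →L[ℝ] ℝ) :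
    ‖B‖ ≤ specNorm (Matrix.of fun i j =>
      B (EuclideanSpace.single i 1) (EuclideanSpace.single j 1)) := by
  set M : Matrix (Fin n) (Fin n) ℝ := (Matrix.of fun i j =>
      B (EuclideanSpace.single i 1) (EuclideanSpace.single j 1)) with hM
  refine ContinuousLinearMap.opNorm_le_bound₂ _ (norm_nonneg _) fun u v => ?_
  have h : B u v = inner ℝ (Matrix.toEuclideanCLM (𝕜 := ℝ) M v) u := by
    rw [bil_expand]
    simp only [PiLp.inner_apply, Matrix.ofLp_toEuclideanCLM, Matrix.mulVec, dotProduct]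
    refine Finset.sum_congr rfl fun i _ => ?_
    simp [Finset.mul_sum, hM, mul_assoc]
  rw [h, Real.norm_eq_abs]
  refine (abs_real_inner_le_norm _ _).trans ?_
  have := (Matrix.toEuclideanCLM (𝕜 := ℝ) M).le_opNorm v
  unfold specNorm
  calc _ ≤ (‖Matrix.toEuclideanCLM (𝕜 := ℝ) M‖ * ‖v‖) * ‖u‖ := by gcongr
    _ = _ := by ring

/-- Taylor data at second order -/
lemma taylor_eq {n : ℕ} (f : E n → ℝ) (y0 x : E n) :
    quadModel (f y0) (gradVec f y0) (hessMat f y0) y0 x =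
      f y0 + fderiv ℝ f y0 (x - y0) + (1 / 2) * fderiv ℝ (fderiv ℝ f) y0 (x - y0) (x - y0) := by
  have h1 : fderiv ℝ f y0 (x - y0) = ∑ i, gradVec f y0 i * (x i - y0 i) := by
    conv_lhs => rw [expand (x - y0)]
    simp only [map_sum, map_smul, smul_eq_mul, gradVec]
    refine Finset.sum_congr rfl fun i _ => ?_
    simp [mul_comm]
  rw [h1, bil_expand]
  simp [quadModel, hessMat]

lemma hasFDerivAt_taylor {n : ℕ} (c : ℝ) (y0 x : E n) (A : E n →L[ℝ] ℝ) (B : E n →L[ℝ] E n →L[ℝ] ℝ)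
    (hB : ∀ u v, B u v = B v u) :
    HasFDerivAt (fun x => c + A (x - y0) + (1 / 2) * B (x - y0) (x - y0)) (A + B (x - y0)) x := by
  have h0 : HasFDerivAt (fun x : E n => x - y0) (ContinuousLinearMap.id ℝ (E n)) x :=
    (hasFDerivAt_id x).sub_const y0
  have h1 := (A.hasFDerivAt (x := x - y0)).comp x h0
  have h2 := (((B.hasFDerivAt (x := x - y0)).comp x h0).clm_apply h0).const_mul (1 / 2 : ℝ)
  have h3 := (h1.const_add c).add h2
  refine h3.congr_fderiv ?_
  ext v
  simp [hB v x, hB v y0]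
  ring

lemma taylor_bounds {n : ℕ} (f : E n → ℝ) (U : Set (E n)) (hU : IsOpen U) (y0 : E n) (r : ℝ)
    (hUball : closedBall y0 r ⊆ U) (hf : ContDiffOn ℝ 2 f U) (L : ℝ) (hL : 0 ≤ L)
    (hr : 0 ≤ r)
    (hLip : ∀ w ∈ U, ∀ z ∈ U, specNorm (hessMat f z - hessMat f w) ≤ L * ‖z - w‖) :
    (hessMat f y0).IsSymm ∧ ∀ x ∈ closedBall y0 r, ∀ w : List (Fin n), w.length ≤ 2 →
      |lpd w f x - lpd w (quadModel (f y0) (gradVec f y0) (hessMat f y0) y0) x|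
        * r ^ w.length ≤ L * r ^ 3 := by
  have hy0 : y0 ∈ closedBall y0 r := mem_closedBall_self hr
  have hat : ∀ x ∈ closedBall y0 r, ContDiffAt ℝ 2 f x := fun x hx =>
    hf.contDiffAt (hU.mem_nhds (hUball hx))
  have hd1 : ∀ x ∈ closedBall y0 r, DifferentiableAt ℝ f x := fun x hx =>
    (hat x hx).differentiableAt (by simp)
  have hd2 : ∀ x ∈ closedBall y0 r, DifferentiableAt ℝ (fderiv ℝ f) x := fun x hx =>
    ((hat x hx).fderiv_right (m := 1) (by norm_num)).differentiableAt (by simp)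
  set A := fderiv ℝ f y0 with hA
  set B := fderiv ℝ (fderiv ℝ f) y0 with hBdef
  have hB : ∀ u v, B u v = B v u := by
    have := (hat y0 hy0).isSymmSndFDerivAt (by simp)
    exact fun u v => this u v
  have hT : quadModel (f y0) (gradVec f y0) (hessMat f y0) y0 =
      fun x => f y0 + A (x - y0) + (1 / 2) * B (x - y0) (x - y0) :=
    funext fun x => taylor_eq f y0 x
  refine ⟨by ext i j; exact hB _ _, ?_⟩
  rw [hT]
  set T : E n → ℝ := fun x => f y0 + A (x - y0) + (1 / 2) * B (x - y0) (x - y0) with hTd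
  have hTf : ∀ x, HasFDerivAt T (A + B (x - y0)) x := fun x => hasFDerivAt_taylor _ y0 x A B hB
  have hTf' : fderiv ℝ T = fun x => A + B (x - y0) := funext fun x => (hTf x).fderiv
  have hTf2 : ∀ x, HasFDerivAt (fun x => A + B (x - y0)) B x := fun x => by
    have h0 : HasFDerivAt (fun x : E n => x - y0) (ContinuousLinearMap.id ℝ (E n)) x :=
      (hasFDerivAt_id x).sub_const y0
    exact ((B.hasFDerivAt (x := x - y0)).comp x h0).const_add A
  have nb : ∀ x ∈ closedBall y0 r, ‖x - y0‖ ≤ r := fun x hx => by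
    simpa [dist_eq_norm] using hx
  -- second order
  have b2 : ∀ x ∈ closedBall y0 r, ‖fderiv ℝ (fderiv ℝ f) x - B‖ ≤ L * r := by
    intro x hx
    refine (bil_norm _).trans ?_
    refine le_trans ?_ ((hLip y0 (hUball hy0) x (hUball hx)).trans
      (mul_le_mul_of_nonneg_left (nb x hx) hL))
    apply le_of_eq
    congr 1
  have cvx : Convex ℝ (closedBall y0 r) := convex_closedBall y0 r
  have b1 : ∀ x ∈ closedBall y0 r, ‖fderiv ℝ f x - (A + B (x - y0))‖ ≤ L * r * r := by
    intro x hx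
    have := cvx.norm_image_sub_le_of_norm_hasFDerivWithin_le
      (f := fun x => fderiv ℝ f x - (A + B (x - y0)))
      (f' := fun x => fderiv ℝ (fderiv ℝ f) x - B) (C := L * r)
      (fun x hx => ((hd2 x hx).hasFDerivAt.sub (hTf2 x)).hasFDerivWithinAt) b2 hy0 hx
    simp only [sub_self, map_zero, add_zero, sub_zero, ← hA] at this
    exact this.trans (mul_le_mul_of_nonneg_left (nb x hx) (by positivity))
  have b0 : ∀ x ∈ closedBall y0 r, ‖f x - T x‖ ≤ L * r * r * r := by
    intro x hx
    have := cvx.norm_image_sub_le_of_norm_hasFDerivWithin_le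
      (f := fun x => f x - T x)
      (f' := fun x => fderiv ℝ f x - (A + B (x - y0))) (C := L * r * r)
      (fun x hx => ((hd1 x hx).hasFDerivAt.sub (hTf x)).hasFDerivWithinAt) b1 hy0 hx
    have h0 : f y0 - T y0 = 0 := by simp [hTd]
    rw [h0, sub_zero] at this
    exact this.trans (mul_le_mul_of_nonneg_left (nb x hx) (by positivity))
  have pdT : ∀ k, pd k T = fun x => (A + B (x - y0)) (EuclideanSpace.single k 1) := by
    intro k; unfold pd; rw [hTf']
  intro x hx w hw
  match w, hw with
  | [], _ =>
    have := b0 x hx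
    simp only [lpd, List.foldr_nil, List.length_nil, pow_zero, mul_one]
    rw [Real.norm_eq_abs] at this
    linarith [show L * r ^ 3 = L * r * r * r by ring]
  | [k], _ =>
    have h := (fderiv ℝ f x - (A + B (x - y0))).le_opNorm (EuclideanSpace.single k 1)
    have h1 := b1 x hx
    simp only [EuclideanSpace.norm_single, norm_one, mul_one] at h
    have e : lpd [k] f x - lpd [k] T x =
        (fderiv ℝ f x - (A + B (x - y0))) (EuclideanSpace.single k 1) := by
      show pd k f x - pd k T x = _
      rw [pdT]; rfl
    rw [e, ← Real.norm_eq_abs]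
    have := h.trans h1
    simp only [List.length_cons, List.length_nil, zero_add, pow_one]
    calc _ ≤ (L * r * r) * r := by gcongr
      _ = _ := by ring
  | [j, k], _ =>
    have h := (fderiv ℝ (fderiv ℝ f) x - B).le_opNorm₂
      (EuclideanSpace.single j 1) (EuclideanSpace.single k 1)
    simp only [EuclideanSpace.norm_single, norm_one, mul_one] at h
    have e : lpd [j, k] f x - lpd [j, k] T x =
        (fderiv ℝ (fderiv ℝ f) x - B) (EuclideanSpace.single j 1) (EuclideanSpace.single k 1) := by
      show pd j (pd k f) x - pd j (pd k T) x = _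
      rw [pdT]
      have e1 := ((hd2 x hx).hasFDerivAt.clm_apply
        (hasFDerivAt_const (EuclideanSpace.single k (1:ℝ) : E n) x)).fderiv
      have e2 := ((hTf2 x).clm_apply
        (hasFDerivAt_const (EuclideanSpace.single k (1:ℝ) : E n) x)).fderiv
      show fderiv ℝ (fun x => fderiv ℝ f x (EuclideanSpace.single k 1)) x
        (EuclideanSpace.single j 1) - fderiv ℝ _ x (EuclideanSpace.single j 1) = _
      rw [e1, e2]
      simp
    rw [e, ← Real.norm_eq_abs]
    have := h.trans (b2 x hx)
    calc _ ≤ (L * r) * r ^ 2 := by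
          simp only [List.length_cons, List.length_nil]; gcongr
      _ = _ := by ring

/-- fully quadratic models: function-value error bound. -/
theorem function_error_bound {n : ℕ} (hn : 1 ≤ n)
    (y : BIdx n → E n) (α : BIdx n → Fin n → ℕ)
    (hα : ∀ i, mdeg (α i) ≤ 2) (h0 : α (Sum.inl ()) = fun _ => 0)
    (hrad : 0 < rad y) (hpoised : IsUnit (Mhat y α))
    (Δ : ℝ) (hΔ : rad y ≤ Δ)
    (f : E n → ℝ) (U : Set (E n)) (hU : IsOpen U)
    (hUball : closedBall (center y) (2 * Δ) ⊆ U)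
    (hf : ContDiffOn ℝ 2 f U) (L : ℝ)
    (hLip : ∀ w ∈ U, ∀ z ∈ U, specNorm (hessMat f z - hessMat f w) ≤ L * ‖z - w‖)
    (c : ℝ) (g : Fin n → ℝ) (H : Matrix (Fin n) (Fin n) ℝ) (hH : H.IsSymm)
    (hinterp : ∀ i, mpd (α i) (quadModel c g H (center y)) (y i) = mpd (α i) f (y i)) :
    ∀ z ∈ closedBall (center y) Δ,
      |quadModel c g H (center y) z - f z|
        ≤ (4 / 3 + 2 * (1 + 2 * Real.sqrt 2) * kfac α * specNorm (Mhat y α)⁻¹)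
            * L * Δ ^ 3 := by
  intro z hz
  set y0 := center y with hy0
  set d := rad y with hd
  have hΔ0 : 0 < Δ := hrad.trans_le hΔ
  have hball : ∀ i, y i ∈ closedBall y0 d := fun i => by
    rw [mem_closedBall, dist_eq_norm]
    exact Finset.le_sup' (fun i => ‖y i - center y‖) (Finset.mem_univ i)
  have hUΔ : closedBall y0 Δ ⊆ U :=
    (closedBall_subset_closedBall (by linarith)).trans hUball
  have hUd : closedBall y0 d ⊆ U := (closedBall_subset_closedBall hΔ).trans hUΔ
  have hL : 0 ≤ L := by
    obtain ⟨i, -, hi⟩ := Finset.exists_mem_eq_sup' Finset.univ_nonempty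
      (fun i => ‖y i - center y‖)
    have hi' : ‖y i - y0‖ = d := hi.symm
    have h1 := hLip y0 (hUd (mem_closedBall_self hrad.le)) (y i) (hUd (hball i))
    rw [hi'] at h1
    have h2 : 0 ≤ L * d := (norm_nonneg _).trans h1
    exact nonneg_of_mul_nonneg_left h2 hrad
  obtain ⟨hsym, hTd⟩ := taylor_bounds f U hU y0 d hUd hf L hL hrad.le hLip
  obtain ⟨-, hTΔ⟩ := taylor_bounds f U hU y0 Δ hUΔ hf L hL hΔ0.le hLip
  have hT0 := hTΔ z hz [] (by simp)
  simp only [lpd, List.foldr_nil, List.length_nil, pow_zero, mul_one] at hT0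
  set T := quadModel (f y0) (gradVec f y0) (hessMat f y0) y0 with hTdef
  have hHs : (H - hessMat f y0).IsSymm := hH.sub hsym
  set v := cvec (c - f y0) (g - gradVec f y0) (H - hessMat f y0) hHs d with hv
  have hp : (fun x => quadModel c g H y0 x - T x) = fun x => evalP v (d⁻¹ • (x - y0)) := by
    rw [hTdef, ← quad_sub]
    funext x
    exact evalP_cvec _ _ _ hHs d hrad.ne' y0 x
  have hevs : ContDiff ℝ ∞ (evalP v) := by
    unfold evalP
    exact ContDiff.sum fun j _ => contDiff_const.mul (contDiff_natBasis j)
  -- residual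
  have hr : ∀ i, |(Mhat y α).mulVec v i| ≤ L * d ^ 3 := by
    intro i
    obtain ⟨w, hw, hwf⟩ := mpd_eq (α i)
    have h1 := hTd (y i) (hball i) w (hw ▸ hα i)
    have h2 := congrFun (lpd_sub w _ _ (contDiff_quad c g H y0)
      (contDiff_quad (f y0) (gradVec f y0) (hessMat f y0) y0)) (y i)
    have h3 := hinterp i
    rw [hwf, hwf] at h3
    rw [h3, ← hTdef, hp, lpd_scale w _ _ _ hevs] at h2
    rw [← h2] at h1
    have h4 : lpd w (evalP v) (d⁻¹ • (y i - y0)) = (Mhat y α).mulVec v i := by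
      unfold evalP
      rw [lpd_sum w v natBasis contDiff_natBasis]
      simp only [Matrix.mulVec, dotProduct, Mhat, Matrix.of_apply, hwf]
      exact Finset.sum_congr rfl fun j _ => mul_comm _ _
    simp only [h4] at h1
    rw [abs_mul, abs_of_pos (by positivity)] at h1
    have : d⁻¹ ^ w.length * |(Mhat y α).mulVec v i| * d ^ w.length
        = |(Mhat y α).mulVec v i| := by
      have := hrad.ne'
      rw [inv_pow]
      field_simp
    linarith
  set r : EuclideanSpace ℝ (BIdx n) := WithLp.toLp 2 ((Mhat y α).mulVec v) with hrdef
  set K := L * d ^ 3 with hK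
  have hK0 : 0 ≤ K := by positivity
  have hk2 : kfac α ^ 2 = ∑ i, (((9 / 4 : ℝ) * if mdeg (α i) = 0 then 1 else 0)
      + (4 * if mdeg (α i) = 1 then 1 else 0) + 4 * if mdeg (α i) = 2 then 1 else 0) := by
    rw [kfac, Real.sq_sqrt (by positivity)]
    simp only [Finset.sum_add_distrib, ← Finset.mul_sum, ncount, Finset.sum_boole]
  have hkn : 0 ≤ kfac α := Real.sqrt_nonneg _
  have hrn : ‖r‖ ≤ kfac α * K := by
    refine abs_le_of_sq_le_sq' ?_ (by positivity) |>.2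
    rw [mul_pow, hk2, EuclideanSpace.norm_sq_eq, Finset.sum_mul]
    refine Finset.sum_le_sum fun i _ => ?_
    have h1 : ‖r i‖ ^ 2 ≤ K ^ 2 := by
      have : ‖r i‖ ≤ K := hr i
      gcongr
    have h2 := hα i
    have h3 : 0 ≤ K ^ 2 := by positivity
    refine h1.trans ?_
    interval_cases h : mdeg (α i) <;> norm_num <;> linarith
  have hvr : WithLp.toLp 2 v = Matrix.toEuclideanCLM (𝕜 := ℝ) (Mhat y α)⁻¹ r := by
    rw [hrdef, Matrix.toEuclideanCLM_toLp, Matrix.mulVec_mulVec,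
      Matrix.nonsing_inv_mul _ ((Matrix.isUnit_iff_isUnit_det _).1 hpoised), Matrix.one_mulVec]
  set S := specNorm (Mhat y α)⁻¹ with hS
  have hS0 : 0 ≤ S := norm_nonneg _
  have hvn : ‖(WithLp.toLp 2 v : EuclideanSpace ℝ (BIdx n))‖ ≤ S * (kfac α * K) := by
    rw [hvr]
    refine ((Matrix.toEuclideanCLM (𝕜 := ℝ) (Mhat y α)⁻¹).le_opNorm r).trans ?_
    exact mul_le_mul_of_nonneg_left hrn hS0
  -- evaluate at z
  set x := d⁻¹ • (z - y0) with hx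
  set ρ := Δ / d with hρ
  have hρ1 : 1 ≤ ρ := (one_le_div hrad).2 hΔ
  have hxρ : ‖x‖ ≤ ρ := by
    rw [hx, norm_smul, Real.norm_eq_abs, abs_of_pos (by positivity), hρ, div_eq_inv_mul]
    have : ‖z - y0‖ ≤ Δ := by simpa [dist_eq_norm] using hz
    gcongr
  have hφ : ‖(WithLp.toLp 2 (fun j => natBasis j x) : EuclideanSpace ℝ (BIdx n))‖ ≤ 2 * ρ ^ 2 := by
    refine abs_le_of_sq_le_sq' ?_ (by positivity) |>.2
    rw [EuclideanSpace.norm_sq_eq]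
    simp only [Real.norm_eq_abs, sq_abs]
    refine (natBasis_norm x).trans ?_
    have h2 : ‖x‖ ^ 2 ≤ ρ ^ 2 := by gcongr
    have h4 : ‖x‖ ^ 4 ≤ ρ ^ 4 := by gcongr
    have : 1 ≤ ρ ^ 2 := one_le_pow₀ hρ1
    nlinarith
  have hpz : |quadModel c g H y0 z - T z| ≤ S * (kfac α * K) * (2 * ρ ^ 2) := by
    have h1 := congrFun hp z
    rw [h1]
    have h2 : evalP v x = inner ℝ (WithLp.toLp 2 (fun j => natBasis j x) : EuclideanSpace ℝ (BIdx n))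
        (WithLp.toLp 2 v) := by
      simp only [PiLp.inner_apply, evalP]
      exact Finset.sum_congr rfl fun j _ => by simp
    rw [← hx, h2]
    refine (abs_real_inner_le_norm _ _).trans ?_
    rw [mul_comm]
    gcongr
  have hKρ : K * ρ ^ 2 ≤ L * Δ ^ 3 := by
    have : K * ρ ^ 2 = L * (d * Δ ^ 2) := by
      rw [hK, hρ]; field_simp
    rw [this]
    apply mul_le_mul_of_nonneg_left _ hL
    nlinarith [sq_nonneg Δ]
  have hs2 : 0 ≤ Real.sqrt 2 := Real.sqrt_nonneg _
  have hLΔ : 0 ≤ L * Δ ^ 3 := by positivity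
  have hkS : 0 ≤ kfac α * S := by positivity
  have e1 : S * (kfac α * K) * (2 * ρ ^ 2) ≤ 2 * (kfac α * S) * (L * Δ ^ 3) := by
    calc _ = 2 * (kfac α * S) * (K * ρ ^ 2) := by ring
      _ ≤ _ := by gcongr
  have e2 : 0 ≤ Real.sqrt 2 * (kfac α * S) * (L * Δ ^ 3) := by positivity
  have e3 : |quadModel c g H y0 z - f z| ≤ |quadModel c g H y0 z - T z| + |f z - T z| := by
    rw [abs_sub_comm (f z)]
    exact abs_sub_le _ _ _
  calc _ ≤ 2 * (kfac α * S) * (L * Δ ^ 3) + L * Δ ^ 3 := by linarith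
    _ ≤ _ := by nlinarith
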